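/- Let N > 0 be even and let A, C : ℝ → ℝ. There exist φ₁, …, φ_N ∈ ℝ and real functions B, D : ℝ → ℝ such that for every θ ∈ ℝ the product R_{φ_N}(θ) · R_{φ_{N-1}}(θ) ⋯ R_{φ_1}(θ) equals A(θ)·𝟙 + i·B(θ)·σz + i·C(θ)·σx + i·D(θ)·σy, if and only if all of the following hold: (1) A(θ)² + C(θ)² ≤ 1 for all θ ∈ ℝ; (2) A(0) = 1; (3) there exist real coefficients a₀, …, a_{N/2} with A(θ) = Σ_{k=0}^{N/2} a_k cos(kθ) for all θ; (4) there exist real coefficients c₁, …, c_{N/2} with C(θ) = Σ_{k=1}^{N/2} c_k sin(kθ) for all θ. -/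

import Mathlib

open Real Complex Matrix

/-- The single-qubit rotation `R_φ(θ)`. -/
noncomputable def Rot (φ θ : ℝ) : Matrix (Fin 2) (Fin 2) ℂ :=
  !![(Real.cos (θ/2) : ℂ), -Complex.I * Complex.exp (-Complex.I * φ) * Real.sin (θ/2);
     -Complex.I * Complex.exp (Complex.I * φ) * Real.sin (θ/2), (Real.cos (θ/2) : ℂ)]

def σx : Matrix (Fin 2) (Fin 2) ℂ := !![0, 1; 1, 0]
def σy : Matrix (Fin 2) (Fin 2) ℂ := !![0, -Complex.I; Complex.I, 0]
def σz : Matrix (Fin 2) (Fin 2) ℂ := !![1, 0; 0, -1]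

/-- The ordered product `R_{φ_N}(θ) ⋯ R_{φ_1}(θ)`, where `φ : Fin N → ℝ` and
`φ 0 = φ_1, …, φ (N-1) = φ_N`. -/
noncomputable def rotProd {N : ℕ} (φ : Fin N → ℝ) (θ : ℝ) : Matrix (Fin 2) (Fin 2) ℂ :=
  ((List.ofFn fun k : Fin N => Rot (φ k) θ).reverse).prod

open Polynomial in
/-- A real polynomial that is nonnegative on `[0, ∞)` has the form `b² + X d²`. -/
theorem exists_sq_add_X_mul_sq (g : ℝ[X]) (hg : ∀ s : ℝ, 0 ≤ s → 0 ≤ g.eval s) :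
    ∃ b d : ℝ[X], g = b ^ 2 + X * d ^ 2 := by
  induction hn : g.natDegree using Nat.strong_induction_on generalizing g with
  | _ n ih =>
  subst hn
  -- the representable polynomials are closed under multiplication
  have key : ∀ f h : ℝ[X], 0 < f.natDegree → g = f * h →
      (∀ s : ℝ, 0 ≤ s → 0 ≤ h.eval s) → (∃ b d : ℝ[X], f = b ^ 2 + X * d ^ 2) →
      ∃ b d : ℝ[X], g = b ^ 2 + X * d ^ 2 := by
    rintro f h hf rfl hh ⟨b, d, hbd⟩
    by_cases h0 : h = 0
    · exact ⟨0, 0, by simp [h0]⟩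
    · have hf0 : f ≠ 0 := by rintro rfl; simp at hf
      obtain ⟨b', d', h'⟩ := ih _ (by rw [natDegree_mul hf0 h0]; omega) h hh rfl
      refine ⟨b * b' - X * d * d', b * d' + d * b', ?_⟩
      rw [h', hbd]; ring
  have hcont : ∀ (h : ℝ[X]) (r : ℝ), 0 ≤ r → (∀ s, r < s → 0 ≤ h.eval s) → 0 ≤ h.eval r := by
    intro h r hr hs
    have ht : Filter.Tendsto (fun s => h.eval s) (nhdsWithin r (Set.Ioi r)) (nhds (h.eval r)) :=
      h.continuous.continuousAt.tendsto.mono_left nhdsWithin_le_nhds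
    exact ge_of_tendsto ht (Filter.eventually_of_mem self_mem_nhdsWithin fun s hs' => hs s hs')
  by_cases hdeg : g.natDegree = 0
  · obtain ⟨c, rfl⟩ := natDegree_eq_zero.1 hdeg
    have hc : 0 ≤ c := by simpa using hg 0 le_rfl
    exact ⟨C √c, 0, by rw [← C_pow, Real.sq_sqrt hc]; simp⟩
  obtain ⟨z, hz⟩ : ∃ z : ℂ, aeval z g = 0 := by
    obtain ⟨z, hz⟩ := Complex.exists_root (f := g.map (algebraMap ℝ ℂ))
      (by rw [degree_map]; exact natDegree_pos_iff_degree_pos.1 (by omega))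
    exact ⟨z, by simpa [aeval_def, eval_map] using hz⟩
  by_cases him : z.im = 0
  · obtain ⟨r, rfl⟩ : ∃ r : ℝ, z = r := ⟨z.re, Complex.ext (by simp) (by simp [him])⟩
    have hr : g.IsRoot r := by
      have : aeval (r : ℂ) g = ((g.eval r : ℝ) : ℂ) := by
        simpa using aeval_algebraMap_apply ℂ r g
      rw [this] at hz
      exact_mod_cast hz
    obtain ⟨h, rfl⟩ := dvd_iff_isRoot.2 hr
    simp only [eval_mul, eval_sub, eval_X, eval_C] at hg
    rcases lt_trichotomy r 0 with h0 | rfl | h0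
    · refine key _ h (by simp) rfl (fun s hs => ?_) ⟨C √(-r), 1, ?_⟩
      · exact nonneg_of_mul_nonneg_right (hg s hs) (by linarith)
      · rw [← C_pow, Real.sq_sqrt (by linarith), C_neg]; ring
    · have hp : ∀ s, 0 < s → 0 ≤ h.eval s := fun s hs =>
        nonneg_of_mul_nonneg_right (hg s hs.le) (by linarith)
      refine key _ h (by simp) rfl (fun s hs => ?_) ⟨0, 1, by simp⟩
      rcases hs.eq_or_lt with rfl | hs
      · exact hcont h 0 le_rfl hp
      · exact hp s hs
    · have hp : ∀ s, r < s → 0 ≤ h.eval s := fun s hs =>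
        nonneg_of_mul_nonneg_right (hg s (by linarith)) (by linarith)
      have h1 := hcont h r h0.le hp
      have h2 : h.eval r ≤ 0 := by
        have ht : Filter.Tendsto (fun s => h.eval s) (nhdsWithin r (Set.Iio r))
            (nhds (h.eval r)) := h.continuous.continuousAt.tendsto.mono_left nhdsWithin_le_nhds
        refine le_of_tendsto ht (Filter.eventually_of_mem (Ioo_mem_nhdsLT h0) fun s hs => ?_)
        nlinarith [hg s hs.1.le, hs.2]
      obtain ⟨k, rfl⟩ := dvd_iff_isRoot.2 (show h.IsRoot r from le_antisymm h2 h1)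
      simp only [eval_mul, eval_sub, eval_X, eval_C] at hg
      have hk : ∀ s, 0 ≤ s → s ≠ r → 0 ≤ k.eval s := fun s hs hsr =>
        nonneg_of_mul_nonneg_right (by linarith [hg s hs]) (by positivity : 0 < (s - r) ^ 2)
      refine key ((X - C r) ^ 2) k (by simp) (by ring) (fun s hs => ?_) ⟨X - C r, 0, by simp⟩
      by_cases hsr : s = r
      · subst hsr
        exact hcont k s hs fun u hu => hk u (by linarith) hu.ne'
      · exact hk s hs hsr
  · obtain ⟨h, hh⟩ := quadratic_dvd_of_aeval_eq_zero_im_ne_zero g hz him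
    have hn : z.re ≤ ‖z‖ := Complex.re_le_norm z
    have hn2 : ‖z‖ ^ 2 = z.re ^ 2 + z.im ^ 2 := by
      rw [← Complex.normSq_eq_norm_sq, Complex.normSq_apply]; ring
    refine key _ h ?_ hh (fun s hs => ?_) ⟨X - C ‖z‖, C √(2 * (‖z‖ - z.re)), ?_⟩
    · have : (X ^ 2 - C (2 * z.re) * X + C (‖z‖ ^ 2) : ℝ[X]).natDegree = 2 := by
        compute_degree!
      omega
    · have := hg s hs
      rw [hh] at this
      simp only [eval_mul, eval_sub, eval_add, eval_pow, eval_X, eval_C] at this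
      refine nonneg_of_mul_nonneg_right this ?_
      have : 0 < z.im ^ 2 := by positivity
      nlinarith [sq_nonneg (s - z.re)]
    · rw [← C_pow, Real.sq_sqrt (by linarith)]
      simp only [C_mul, C_sub, C_pow, map_ofNat]
      ring

theorem rotProd_succ {N : ℕ} (φ : Fin (N + 1) → ℝ) (θ : ℝ) :
    rotProd φ θ = Rot (φ (Fin.last N)) θ * rotProd (fun k => φ k.castSucc) θ := by
  rw [rotProd, List.ofFn_succ', List.concat_eq_append]
  simp [rotProd]

theorem rotProd_succ_zero_zero {N : ℕ} (φ : Fin (N + 1) → ℝ) (θ : ℝ) :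
    rotProd φ θ 0 0 = Real.cos (θ / 2) * rotProd (fun k => φ k.castSucc) θ 0 0 +
      -Complex.I * Complex.exp (-Complex.I * φ (Fin.last N)) * Real.sin (θ / 2) *
        rotProd (fun k => φ k.castSucc) θ 1 0 := by
  rw [rotProd_succ, Matrix.mul_apply, Fin.sum_univ_two]
  simp [Rot]

theorem rotProd_succ_one_zero {N : ℕ} (φ : Fin (N + 1) → ℝ) (θ : ℝ) :
    rotProd φ θ 1 0 = -Complex.I * Complex.exp (Complex.I * φ (Fin.last N)) *
      Real.sin (θ / 2) * rotProd (fun k => φ k.castSucc) θ 0 0 +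
        Real.cos (θ / 2) * rotProd (fun k => φ k.castSucc) θ 1 0 := by
  rw [rotProd_succ, Matrix.mul_apply, Fin.sum_univ_two]
  simp [Rot]

theorem conj_exp_I_mul (φ : ℝ) :
    (starRingEnd ℂ) (Complex.exp (Complex.I * φ)) = Complex.exp (-Complex.I * φ) := by
  rw [← Complex.exp_conj]; simp

theorem exp_neg_I_mul_mul_exp_I_mul (φ : ℝ) :
    Complex.exp (-Complex.I * φ) * Complex.exp (Complex.I * φ) = 1 := by
  rw [← Complex.exp_add]; simp

theorem det_Rot (φ θ : ℝ) : (Rot φ θ).det = 1 := by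
  have h : (Real.sin (θ / 2) : ℂ) ^ 2 + (Real.cos (θ / 2) : ℂ) ^ 2 = 1 := by
    exact_mod_cast Real.sin_sq_add_cos_sq (θ / 2)
  rw [Rot, Matrix.det_fin_two_of]
  linear_combination h - Complex.I ^ 2 * (Real.sin (θ / 2) : ℂ) ^ 2 *
    exp_neg_I_mul_mul_exp_I_mul φ - (Real.sin (θ / 2) : ℂ) ^ 2 * Complex.I_sq

theorem det_rotProd {N : ℕ} (φ : Fin N → ℝ) (θ : ℝ) : (rotProd φ θ).det = 1 := by
  induction N with
  | zero => simp [rotProd]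
  | succ N ih => rw [rotProd_succ, Matrix.det_mul, det_Rot, ih, one_mul]

theorem rotProd_conj {N : ℕ} (φ : Fin N → ℝ) (θ : ℝ) :
    rotProd φ θ 1 1 = (starRingEnd ℂ) (rotProd φ θ 0 0) ∧
      rotProd φ θ 0 1 = -(starRingEnd ℂ) (rotProd φ θ 1 0) := by
  induction N with
  | zero => simp [rotProd]
  | succ N ih =>
    obtain ⟨h1, h2⟩ := ih fun k => φ k.castSucc
    have hc : (starRingEnd ℂ) (Complex.exp (-Complex.I * φ (Fin.last N))) =
        Complex.exp (Complex.I * φ (Fin.last N)) := by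
      rw [← conj_exp_I_mul, Complex.conj_conj]
    rw [rotProd_succ_zero_zero, rotProd_succ_one_zero, rotProd_succ]
    simp only [Matrix.mul_apply, Fin.sum_univ_two, h1, h2, map_add, map_mul, map_neg,
      Complex.conj_I, Complex.conj_ofReal, hc, conj_exp_I_mul]
    constructor
    · simp [Rot]; ring
    · simp [Rot]

theorem continuous_rotProd {N : ℕ} (φ : Fin N → ℝ) : Continuous (rotProd φ) := by
  induction N with
  | zero => exact continuous_const (y := (1 : Matrix (Fin 2) (Fin 2) ℂ)) |>.congr (by simp [rotProd])
  | succ N ih =>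
    have hR : Continuous (Rot (φ (Fin.last N))) := by
      refine continuous_matrix fun i j => ?_
      fin_cases i <;> fin_cases j <;> simp [Rot] <;> fun_prop
    exact (hR.mul (ih _)).congr fun θ => (rotProd_succ φ θ).symm

open Polynomial in
theorem eq_one_of_mul_conj_add_X_mul_eq_one {p q : ℂ[X]}
    (h : p * p.map (starRingEnd ℂ) + X * (q * q.map (starRingEnd ℂ)) = 1)
    (h0 : p.eval 0 = 1) : p = 1 ∧ q = 0 := by
  have hinj : Function.Injective (starRingEnd ℂ) := (starRingEnd ℂ).injective
  have hmap : ∀ r : ℂ[X], (r.map (starRingEnd ℂ)).natDegree = r.natDegree :=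
    fun r => natDegree_map_eq_of_injective hinj r
  have hmap0 : ∀ r : ℂ[X], r ≠ 0 → r.map (starRingEnd ℂ) ≠ 0 :=
    fun r hr => (Polynomial.map_ne_zero_iff hinj).2 hr
  have hp : p ≠ 0 := by rintro rfl; simp at h0
  have hpd : (p * p.map (starRingEnd ℂ)).natDegree = p.natDegree + p.natDegree := by
    rw [natDegree_mul hp (hmap0 p hp), hmap]
  have hq : q = 0 := by
    by_contra hq
    have hqd : (X * (q * q.map (starRingEnd ℂ))).natDegree = 1 + (q.natDegree + q.natDegree) := by
      rw [natDegree_mul X_ne_zero (mul_ne_zero hq (hmap0 q hq)), natDegree_X,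
        natDegree_mul hq (hmap0 q hq), hmap]
    have hd := congrArg natDegree h
    rw [natDegree_one] at hd
    rcases lt_or_ge (p * p.map (starRingEnd ℂ)).natDegree
      (X * (q * q.map (starRingEnd ℂ))).natDegree with hlt | hge
    · rw [natDegree_add_eq_right_of_natDegree_lt hlt] at hd
      omega
    · rw [natDegree_add_eq_left_of_natDegree_lt (by omega)] at hd
      omega
  subst hq
  have hd := congrArg natDegree h
  simp only [zero_mul, mul_zero, add_zero, natDegree_one, hpd] at hd
  obtain ⟨c, rfl⟩ := natDegree_eq_zero.1 (show p.natDegree = 0 by omega)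
  simp only [eval_C] at h0
  exact ⟨by simp [h0], rfl⟩

theorem exists_phase_of_norm_eq {P Q : ℂ} (h : ‖P‖ = ‖Q‖) :
    ∃ φ : ℝ, Q = -Complex.I * Complex.exp (Complex.I * φ) * P := by
  by_cases hP : P = 0
  · subst hP
    exact ⟨0, by simpa using h.symm⟩
  · refine ⟨(Complex.I * (Q / P)).arg, ?_⟩
    have h1 : ‖Complex.I * (Q / P)‖ = 1 := by
      rw [norm_mul, Complex.norm_I, one_mul, norm_div, h, div_self]
      rw [← h]; exact norm_ne_zero_iff.2 hP
    have h2 := Complex.norm_mul_exp_arg_mul_I (Complex.I * (Q / P))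
    rw [h1, Complex.ofReal_one, one_mul, mul_comm _ Complex.I] at h2
    rw [h2]
    field_simp
    linear_combination Q * Complex.I_sq

open Polynomial in
/-- Quantum signal processing: a pair of polynomials in `tan² (θ / 2)` satisfying the
normalization condition is realized by a product of rotations. -/
theorem exists_rotProd_eq (N : ℕ) (p q : ℂ[X])
    (h : p * p.map (starRingEnd ℂ) + X * (q * q.map (starRingEnd ℂ)) = (1 + X) ^ N)
    (h0 : p.eval 0 = 1) :
    ∃ φ : Fin N → ℝ, ∀ θ : ℝ, Real.cos (θ / 2) ≠ 0 →
      rotProd φ θ 0 0 = (Real.cos (θ / 2) : ℂ) ^ N * p.eval ((Real.tan (θ / 2) : ℂ) ^ 2) ∧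
      rotProd φ θ 1 0 = (Real.cos (θ / 2) : ℂ) ^ N *
        (Real.tan (θ / 2) * q.eval ((Real.tan (θ / 2) : ℂ) ^ 2)) := by
  induction N generalizing p q with
  | zero =>
    obtain ⟨rfl, rfl⟩ := eq_one_of_mul_conj_add_X_mul_eq_one (by simpa using h) h0
    exact ⟨Fin.elim0, fun θ _ => by simp [rotProd]⟩
  | succ N ih =>
    have hconj : ∀ r : ℂ[X],
        (r.map (starRingEnd ℂ)).eval (-1) = (starRingEnd ℂ) (r.eval (-1)) := by
      intro r
      have := eval_map_apply (f := starRingEnd ℂ) (p := r) (-1)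
      simpa using this
    have hn : ‖p.eval (-1)‖ = ‖q.eval (-1)‖ := by
      have h1 := congrArg (eval (-1)) h
      simp only [eval_add, eval_mul, eval_X, hconj, Complex.mul_conj, eval_pow, eval_one,
        Complex.normSq_eq_norm_sq] at h1
      have h2 : ‖p.eval (-1)‖ ^ 2 = ‖q.eval (-1)‖ ^ 2 := by
        have : ((‖p.eval (-1)‖ ^ 2 : ℝ) : ℂ) = ((‖q.eval (-1)‖ ^ 2 : ℝ) : ℂ) := by
          rw [add_neg_cancel, zero_pow (by omega)] at h1
          linear_combination h1
        exact_mod_cast this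
      exact (sq_eq_sq₀ (norm_nonneg _) (norm_nonneg _)).1 h2
    obtain ⟨φ₀, hφ₀⟩ := exists_phase_of_norm_eq hn
    have hee := exp_neg_I_mul_mul_exp_I_mul φ₀
    have hconj1 := conj_exp_I_mul φ₀
    have hconj2 : (starRingEnd ℂ) (Complex.exp (-Complex.I * φ₀)) =
        Complex.exp (Complex.I * φ₀) := by
      rw [← conj_exp_I_mul, Complex.conj_conj]
    set e := Complex.exp (Complex.I * φ₀) with he
    set e' := Complex.exp (-Complex.I * φ₀) with he'
    have hX : (X - C (-1) : ℂ[X]) = 1 + X := by simp [add_comm]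
    have hX0 : (1 + X : ℂ[X]) ≠ 0 := by rw [← hX]; exact X_sub_C_ne_zero _
    obtain ⟨p₂, hp₂⟩ : (1 + X) ∣ p + C (Complex.I * e') * X * q := by
      rw [← hX, dvd_iff_isRoot]
      simp only [IsRoot, eval_add, eval_mul, eval_X, eval_C, hφ₀]
      linear_combination (eval (-1) p) * (Complex.I ^ 2 * hee + Complex.I_sq)
    obtain ⟨q₂, hq₂⟩ : (1 + X) ∣ q + C (Complex.I * e) * p := by
      rw [← hX, dvd_iff_isRoot]
      simp only [IsRoot, eval_add, eval_mul, eval_C, hφ₀]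
      ring
    have hI : (C Complex.I : ℂ[X]) ^ 2 = -1 := by rw [← C_pow, Complex.I_sq]; simp
    have hE : (C e' : ℂ[X]) * C e = 1 := by rw [← C_mul, hee, C_1]
    have hp₂' := congrArg (Polynomial.map (starRingEnd ℂ)) hp₂
    have hq₂' := congrArg (Polynomial.map (starRingEnd ℂ)) hq₂
    simp only [Polynomial.map_add, Polynomial.map_mul, Polynomial.map_one, map_X, map_C,
      map_mul, Complex.conj_I, hconj1, hconj2, C_neg] at hp₂ hq₂ hp₂' hq₂'
    have hp : p = p₂ - C (Complex.I * e') * X * q₂ := by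
      refine mul_left_cancel₀ hX0 ?_
      rw [C_mul]
      linear_combination hp₂ - C Complex.I * C e' * X * hq₂ + X * p * (hI + C Complex.I ^ 2 * hE)
    have hq : q = q₂ - C (Complex.I * e) * p₂ := by
      refine mul_left_cancel₀ hX0 ?_
      rw [C_mul]
      linear_combination hq₂ - C Complex.I * C e * hp₂ + X * q * (hI + C Complex.I ^ 2 * hE)
    obtain ⟨φ, hφ⟩ := ih p₂ q₂ (by
      refine mul_left_cancel₀ (pow_ne_zero 2 hX0) ?_
      calc (1 + X) ^ 2 * (p₂ * p₂.map (starRingEnd ℂ) + X * (q₂ * q₂.map (starRingEnd ℂ)))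
          = ((1 + X) * p₂) * ((1 + X) * p₂.map (starRingEnd ℂ)) +
            X * (((1 + X) * q₂) * ((1 + X) * q₂.map (starRingEnd ℂ))) := by ring
        _ = (1 + X) * (p * p.map (starRingEnd ℂ) + X * (q * q.map (starRingEnd ℂ))) := by
          rw [← hp₂, ← hq₂, ← hp₂', ← hq₂']
          linear_combination -(X * (X * q * q.map (starRingEnd ℂ) + p * p.map (starRingEnd ℂ))) *
            (hI + C Complex.I ^ 2 * hE)
        _ = (1 + X) ^ 2 * (1 + X) ^ N := by rw [h]; ring) (by
      have := congrArg (eval 0) hp₂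
      simpa [h0] using this.symm)
    refine ⟨Fin.snoc (α := fun _ => ℝ) φ φ₀, fun θ hθ => ?_⟩
    obtain ⟨h1, h2⟩ := hφ θ hθ
    have hs : (Real.sin (θ / 2) : ℂ) = Real.cos (θ / 2) * Real.tan (θ / 2) := by
      rw [mul_comm]; exact_mod_cast (Real.tan_mul_cos hθ).symm
    rw [rotProd_succ_zero_zero, rotProd_succ_one_zero]
    simp only [Fin.snoc_last, Fin.snoc_castSucc, h1, h2, hs, ← he, ← he']
    constructor
    · rw [hp]
      simp only [eval_sub, eval_mul, eval_C, eval_X]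
      ring
    · rw [hq]
      simp only [eval_sub, eval_mul, eval_C]
      ring

theorem mul_mem_span_range {N : ℕ} {g f : ℝ → ℂ} {u : Fin (N + 1) → ℝ → ℂ}
    {v : Fin (N + 2) → ℝ → ℂ} (a b : ℂ)
    (h : ∀ k, g * u k = a • v k.castSucc + b • v k.succ)
    (hf : f ∈ Submodule.span ℂ (Set.range u)) : g * f ∈ Submodule.span ℂ (Set.range v) := by
  suffices Submodule.span ℂ (Set.range u) ≤
      (Submodule.span ℂ (Set.range v)).comap (LinearMap.mulLeft ℂ g) from this hf
  rw [Submodule.span_le]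
  rintro _ ⟨k, rfl⟩
  simp only [SetLike.mem_coe, Submodule.mem_comap, LinearMap.mulLeft_apply, h]
  exact add_mem (Submodule.smul_mem _ _ (Submodule.subset_span ⟨_, rfl⟩))
    (Submodule.smul_mem _ _ (Submodule.subset_span ⟨_, rfl⟩))

/-- The functions `cos ((N - 2k) θ / 2)` for `k ≤ N`. -/
noncomputable def cosMode (N : ℕ) (k : Fin (N + 1)) (θ : ℝ) : ℂ :=
  Real.cos (((N : ℝ) - 2 * (k : ℕ)) * (θ / 2))

/-- The functions `sin ((N - 2k) θ / 2)` for `k ≤ N`. -/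
noncomputable def sinMode (N : ℕ) (k : Fin (N + 1)) (θ : ℝ) : ℂ :=
  Real.sin (((N : ℝ) - 2 * (k : ℕ)) * (θ / 2))

theorem mode_succ_arg (N : ℕ) (k : ℕ) (x : ℝ) :
    (((N + 1 : ℕ) : ℝ) - 2 * k) * x = ((N : ℝ) - 2 * k) * x + x ∧
      (((N + 1 : ℕ) : ℝ) - 2 * (k + 1 : ℕ)) * x = ((N : ℝ) - 2 * k) * x - x := by
  push_cast
  constructor <;> ring

theorem cos_mul_cosMode (N : ℕ) (k : Fin (N + 1)) :
    (fun θ : ℝ => (Real.cos (θ / 2) : ℂ)) * cosMode N k =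
      (1 / 2 : ℂ) • cosMode (N + 1) k.castSucc + (1 / 2 : ℂ) • cosMode (N + 1) k.succ := by
  ext θ
  obtain ⟨h1, h2⟩ := mode_succ_arg N k (θ / 2)
  simp only [Pi.mul_apply, Pi.add_apply, Pi.smul_apply, smul_eq_mul, cosMode, Fin.val_castSucc,
    Fin.val_succ, h1, h2, Real.cos_add, Real.cos_sub]
  push_cast
  ring

theorem cos_mul_sinMode (N : ℕ) (k : Fin (N + 1)) :
    (fun θ : ℝ => (Real.cos (θ / 2) : ℂ)) * sinMode N k =
      (1 / 2 : ℂ) • sinMode (N + 1) k.castSucc + (1 / 2 : ℂ) • sinMode (N + 1) k.succ := by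
  ext θ
  obtain ⟨h1, h2⟩ := mode_succ_arg N k (θ / 2)
  simp only [Pi.mul_apply, Pi.add_apply, Pi.smul_apply, smul_eq_mul, sinMode, Fin.val_castSucc,
    Fin.val_succ, h1, h2, Real.sin_add, Real.sin_sub]
  push_cast
  ring

theorem sin_mul_cosMode (N : ℕ) (k : Fin (N + 1)) :
    (fun θ : ℝ => (Real.sin (θ / 2) : ℂ)) * cosMode N k =
      (1 / 2 : ℂ) • sinMode (N + 1) k.castSucc + (-1 / 2 : ℂ) • sinMode (N + 1) k.succ := by
  ext θ
  obtain ⟨h1, h2⟩ := mode_succ_arg N k (θ / 2)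
  simp only [Pi.mul_apply, Pi.add_apply, Pi.smul_apply, smul_eq_mul, sinMode, cosMode,
    Fin.val_castSucc, Fin.val_succ, h1, h2, Real.sin_add, Real.sin_sub]
  push_cast
  ring

theorem sin_mul_sinMode (N : ℕ) (k : Fin (N + 1)) :
    (fun θ : ℝ => (Real.sin (θ / 2) : ℂ)) * sinMode N k =
      (-1 / 2 : ℂ) • cosMode (N + 1) k.castSucc + (1 / 2 : ℂ) • cosMode (N + 1) k.succ := by
  ext θ
  obtain ⟨h1, h2⟩ := mode_succ_arg N k (θ / 2)
  simp only [Pi.mul_apply, Pi.add_apply, Pi.smul_apply, smul_eq_mul, sinMode, cosMode,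
    Fin.val_castSucc, Fin.val_succ, h1, h2, Real.cos_add, Real.cos_sub]
  push_cast
  ring

theorem rotProd_mem_span {N : ℕ} (φ : Fin N → ℝ) :
    (fun θ => rotProd φ θ 0 0) ∈ Submodule.span ℂ (Set.range (cosMode N)) ∧
      (fun θ => rotProd φ θ 1 0) ∈ Submodule.span ℂ (Set.range (sinMode N)) := by
  induction N with
  | zero =>
    constructor
    · exact Submodule.subset_span ⟨0, by ext; simp [cosMode, rotProd]⟩
    · have h : (fun θ => rotProd φ θ 1 0) = 0 := by ext; simp [rotProd]
      rw [h]
      exact Submodule.zero_mem _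
  | succ N ih =>
    obtain ⟨hP, hQ⟩ := ih fun k => φ k.castSucc
    constructor
    · convert! add_mem (mul_mem_span_range _ _ (cos_mul_cosMode N) hP)
        (Submodule.smul_mem _ (-Complex.I * Complex.exp (-Complex.I * φ (Fin.last N)))
          (mul_mem_span_range _ _ (sin_mul_sinMode N) hQ)) using 1
      ext θ
      simp only [rotProd_succ_zero_zero, Pi.add_apply, Pi.mul_apply, Pi.smul_apply, smul_eq_mul]
      ring
    · convert! add_mem (mul_mem_span_range _ _ (cos_mul_sinMode N) hQ)
        (Submodule.smul_mem _ (-Complex.I * Complex.exp (Complex.I * φ (Fin.last N)))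
          (mul_mem_span_range _ _ (sin_mul_cosMode N) hP)) using 1
      ext θ
      simp only [rotProd_succ_one_zero, Pi.add_apply, Pi.mul_apply, Pi.smul_apply, smul_eq_mul]
      ring

theorem exists_real_coeff_of_mem_span {ι : Type*} [Fintype ι] {f : ℝ → ℂ} {u : ι → ℝ → ℝ}
    (hf : f ∈ Submodule.span ℂ (Set.range fun k θ => (u k θ : ℂ))) (z : ℂ) :
    ∃ a : ι → ℝ, ∀ θ, (z * f θ).re = ∑ k, a k * u k θ := by
  obtain ⟨c, rfl⟩ := (Submodule.mem_span_range_iff_exists_fun ℂ).1 hf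
  refine ⟨fun k => (z * c k).re, fun θ => ?_⟩
  simp only [Finset.sum_apply, Pi.smul_apply, smul_eq_mul, Finset.mul_sum, Complex.re_sum,
    ← mul_assoc, Complex.re_mul_ofReal]

theorem span_cosMode_le (n : ℕ) :
    Submodule.span ℂ (Set.range (cosMode (n + n))) ≤ Submodule.span ℂ
      (Set.range fun (k : Fin (n + 1)) (θ : ℝ) => (Real.cos ((k : ℕ) * θ) : ℂ)) := by
  rw [Submodule.span_le]
  rintro _ ⟨⟨k, hk⟩, rfl⟩
  rcases le_total k n with h | h
  · refine Submodule.subset_span ⟨⟨n - k, by omega⟩, ?_⟩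
    ext θ
    simp only [cosMode, Nat.cast_sub h, Nat.cast_add]
    congr 2
    ring
  · refine Submodule.subset_span ⟨⟨k - n, by omega⟩, ?_⟩
    ext θ
    simp only [cosMode, Nat.cast_sub h, Nat.cast_add]
    rw [← Real.cos_neg]
    congr 2
    ring

theorem span_sinMode_le (n : ℕ) :
    Submodule.span ℂ (Set.range (sinMode (n + n))) ≤ Submodule.span ℂ
      (Set.range fun (k : Fin n) (θ : ℝ) => (Real.sin (((k : ℕ) + 1) * θ) : ℂ)) := by
  rw [Submodule.span_le]
  rintro _ ⟨⟨k, hk⟩, rfl⟩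
  rcases lt_trichotomy k n with h | rfl | h
  · obtain ⟨m, rfl⟩ := Nat.exists_eq_add_of_lt h
    refine Submodule.subset_span ⟨⟨m, by omega⟩, ?_⟩
    ext θ
    simp only [sinMode]
    congr 2
    push_cast
    ring
  · have h : sinMode (k + k) ⟨k, hk⟩ = 0 := by
      ext
      simp [sinMode, ← two_mul]
    rw [h]
    exact Submodule.zero_mem _
  · obtain ⟨m, rfl⟩ := Nat.exists_eq_add_of_lt h
    rw [SetLike.mem_coe, ← neg_mem_iff]
    refine Submodule.subset_span ⟨⟨m, by omega⟩, ?_⟩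
    ext θ
    simp only [sinMode, Pi.neg_apply, ← Complex.ofReal_neg, ← Real.sin_neg]
    congr 2
    push_cast
    ring

open Polynomial in
theorem exists_cos_sin_eq_eval_tan_sq (k : ℕ) : ∃ p q : ℝ[X], ∀ θ : ℝ, Real.cos (θ / 2) ≠ 0 →
    Real.cos (k * θ) = Real.cos (θ / 2) ^ (k + k) * p.eval (Real.tan (θ / 2) ^ 2) ∧
    Real.sin (k * θ) =
      Real.cos (θ / 2) ^ (k + k) * (Real.tan (θ / 2) * q.eval (Real.tan (θ / 2) ^ 2)) := by
  induction k with
  | zero => exact ⟨1, 0, by simp⟩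
  | succ k ih =>
    obtain ⟨p, q, h⟩ := ih
    refine ⟨(1 - X) * p - 2 * X * q, 2 * p + (1 - X) * q, fun θ hθ => ?_⟩
    obtain ⟨h1, h2⟩ := h θ hθ
    have hs : Real.sin (θ / 2) = Real.cos (θ / 2) * Real.tan (θ / 2) := by
      rw [mul_comm, Real.tan_mul_cos hθ]
    have hcθ : Real.cos θ = Real.cos (θ / 2) ^ 2 * (1 - Real.tan (θ / 2) ^ 2) := by
      conv_lhs => rw [← mul_div_cancel₀ θ (two_ne_zero' ℝ), Real.cos_two_mul']
      rw [hs]; ring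
    have hsθ : Real.sin θ = 2 * Real.cos (θ / 2) ^ 2 * Real.tan (θ / 2) := by
      conv_lhs => rw [← mul_div_cancel₀ θ (two_ne_zero' ℝ), Real.sin_two_mul]
      rw [hs]; ring
    rw [Nat.cast_succ, add_one_mul, Real.cos_add, Real.sin_add, h1, h2, hcθ, hsθ]
    simp only [eval_add, eval_sub, eval_mul, eval_X, eval_one, eval_ofNat]
    constructor <;> ring

theorem cos_pow_eq_of_le {k n : ℕ} (hkn : k ≤ n) {x : ℝ} (hx : Real.cos x ≠ 0) :
    Real.cos x ^ (k + k) = Real.cos x ^ (n + n) * (1 + Real.tan x ^ 2) ^ (n - k) := by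
  obtain ⟨m, rfl⟩ := Nat.exists_eq_add_of_le hkn
  have h : Real.cos x ^ 2 * (1 + Real.tan x ^ 2) = 1 := by
    rw [← Real.inv_one_add_tan_sq hx, inv_mul_cancel₀ (by positivity)]
  calc Real.cos x ^ (k + k)
      = Real.cos x ^ (k + k) * (Real.cos x ^ 2 * (1 + Real.tan x ^ 2)) ^ m := by simp [h]
    _ = _ := by rw [Nat.add_sub_cancel_left, mul_pow]; ring

open Polynomial in
theorem exists_cos_sum_eq_eval_tan_sq {n : ℕ} (a : Fin (n + 1) → ℝ) :
    ∃ p : ℝ[X], ∀ θ : ℝ, Real.cos (θ / 2) ≠ 0 → ∑ k, a k * Real.cos ((k : ℕ) * θ) =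
      Real.cos (θ / 2) ^ (n + n) * p.eval (Real.tan (θ / 2) ^ 2) := by
  choose p q h using exists_cos_sin_eq_eval_tan_sq
  refine ⟨∑ k : Fin (n + 1), C (a k) * ((1 + X) ^ (n - k) * p k), fun θ hθ => ?_⟩
  rw [eval_finsetSum, Finset.mul_sum]
  refine Finset.sum_congr rfl fun k _ => ?_
  rw [(h k θ hθ).1, cos_pow_eq_of_le (Nat.lt_succ_iff.1 k.2) hθ]
  simp only [eval_mul, eval_C, eval_pow, eval_add, eval_one, eval_X]
  ring

open Polynomial in
theorem exists_sin_sum_eq_eval_tan_sq {n : ℕ} (c : Fin n → ℝ) :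
    ∃ q : ℝ[X], ∀ θ : ℝ, Real.cos (θ / 2) ≠ 0 → ∑ k, c k * Real.sin (((k : ℕ) + 1) * θ) =
      Real.cos (θ / 2) ^ (n + n) * (Real.tan (θ / 2) * q.eval (Real.tan (θ / 2) ^ 2)) := by
  choose p q h using exists_cos_sin_eq_eval_tan_sq
  refine ⟨∑ k : Fin n, C (c k) * ((1 + X) ^ (n - (k + 1)) * q (k + 1)), fun θ hθ => ?_⟩
  rw [eval_finsetSum, Finset.mul_sum, Finset.mul_sum]
  refine Finset.sum_congr rfl fun k _ => ?_
  have := (h (k + 1) θ hθ).2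
  rw [cos_pow_eq_of_le (Nat.succ_le_iff.2 k.2) hθ, Nat.cast_succ] at this
  rw [this]
  simp only [eval_mul, eval_C, eval_pow, eval_add, eval_one, eval_X]
  ring

theorem dense_setOf_cos_half_ne_zero : Dense {θ : ℝ | Real.cos (θ / 2) ≠ 0} := by
  have h : {θ : ℝ | Real.cos (θ / 2) = 0} ⊆ Set.range fun k : ℤ => (2 * k + 1) * Real.pi := by
    intro θ hθ
    obtain ⟨k, hk⟩ := Real.cos_eq_zero_iff.1 hθ
    exact ⟨k, by linarith⟩
  exact ((Set.countable_range _).mono h).dense_compl ℝ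

theorem eq_pauli_combination_of_conj {M : Matrix (Fin 2) (Fin 2) ℂ}
    (h1 : M 1 1 = (starRingEnd ℂ) (M 0 0)) (h2 : M 0 1 = -(starRingEnd ℂ) (M 1 0)) :
    M = ((M 0 0).re : ℂ) • (1 : Matrix (Fin 2) (Fin 2) ℂ) +
      (Complex.I * ((M 0 0).im : ℂ)) • σz + (Complex.I * ((M 1 0).im : ℂ)) • σx +
      (Complex.I * ((-(M 1 0).re : ℝ) : ℂ)) • σy := by
  ext i j
  fin_cases i <;> fin_cases j <;> simp [σx, σy, σz, h1, h2, Complex.ext_iff]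

open Polynomial in
theorem exists_rotProd_re_im_eq {n : ℕ} {A C : ℝ → ℝ} (hAC : ∀ θ, A θ ^ 2 + C θ ^ 2 ≤ 1)
    (hA0 : A 0 = 1) (a : Fin (n + 1) → ℝ) (hA : ∀ θ, A θ = ∑ k, a k * Real.cos ((k : ℕ) * θ))
    (c : Fin n → ℝ) (hC : ∀ θ, C θ = ∑ k, c k * Real.sin (((k : ℕ) + 1) * θ)) :
    ∃ φ : Fin (n + n) → ℝ, ∀ θ, (rotProd φ θ 0 0).re = A θ ∧ (rotProd φ θ 1 0).im = C θ := by
  obtain ⟨p, hp⟩ := exists_cos_sum_eq_eval_tan_sq a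
  obtain ⟨q, hq⟩ := exists_sin_sum_eq_eval_tan_sq c
  simp only [← hA] at hp
  simp only [← hC] at hq
  obtain ⟨b, d, hbd⟩ := exists_sq_add_X_mul_sq ((1 + X) ^ (n + n) - p ^ 2 - X * q ^ 2) (by
    intro s hs
    have hpos := Real.cos_arctan_pos √s
    have h2 : 2 * Real.arctan √s / 2 = Real.arctan √s := by ring
    have hp' := hp (2 * Real.arctan √s)
    have hq' := hq (2 * Real.arctan √s)
    rw [h2, Real.tan_arctan, Real.sq_sqrt hs] at hp' hq'
    have h := hAC (2 * Real.arctan √s)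
    rw [hp' hpos.ne', hq' hpos.ne'] at h
    have h1 : Real.cos (Real.arctan √s) ^ 2 * (1 + s) = 1 := by
      rw [Real.cos_sq_arctan, Real.sq_sqrt hs]
      field_simp
    simp only [eval_sub, eval_mul, eval_pow, eval_add, eval_X, eval_one]
    refine nonneg_of_mul_nonneg_right (a := (Real.cos (Real.arctan √s) ^ (n + n)) ^ 2) ?_
      (by positivity)
    have h3 : (Real.cos (Real.arctan √s) ^ (n + n)) ^ 2 * (1 + s) ^ (n + n) = 1 := by
      rw [← pow_mul, mul_comm (n + n), pow_mul, ← mul_pow, h1, one_pow]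
    rw [mul_pow, mul_pow, mul_pow √s, Real.sq_sqrt hs] at h
    linarith)
  have hp0 : p.eval 0 = 1 := by simpa [hA0] using (hp 0 (by simp)).symm
  have hb0 : b.eval 0 = 0 := by
    have := congrArg (eval 0) hbd
    simpa [hp0] using this.symm
  have hmap : ∀ r : ℝ[X], (r.map (algebraMap ℝ ℂ)).map (starRingEnd ℂ) =
      r.map (algebraMap ℝ ℂ) := by
    intro r
    rw [Polynomial.map_map]
    congr 1
    ext x
    simp
  have heval : ∀ (r : ℝ[X]) (x : ℝ),
      (r.map (algebraMap ℝ ℂ)).eval (x : ℂ) = ((r.eval x : ℝ) : ℂ) :=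
    fun r x => eval_map_apply (f := algebraMap ℝ ℂ) (p := r) x
  obtain ⟨φ, hφ⟩ := exists_rotProd_eq (n + n)
    (p.map (algebraMap ℝ ℂ) + Polynomial.C Complex.I * b.map (algebraMap ℝ ℂ))
    (Polynomial.C Complex.I * q.map (algebraMap ℝ ℂ) - d.map (algebraMap ℝ ℂ)) (by
      have h := congrArg (Polynomial.map (algebraMap ℝ ℂ)) hbd
      have hI : (Polynomial.C Complex.I : ℂ[X]) ^ 2 = -1 := by
        rw [← C_pow, Complex.I_sq]; simp
      simp only [Polynomial.map_add, Polynomial.map_sub, Polynomial.map_mul, Polynomial.map_pow,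
        Polynomial.map_one, map_X, map_C, hmap, Complex.conj_I, C_neg] at h ⊢
      linear_combination -h - (b.map (algebraMap ℝ ℂ) ^ 2 + X * q.map (algebraMap ℝ ℂ) ^ 2) * hI)
    (by
      have h1 := heval p 0
      have h2 := heval b 0
      rw [Complex.ofReal_zero] at h1 h2
      simp [h1, h2, hp0, hb0])
  have hent : ∀ i j, Continuous fun θ => rotProd φ θ i j :=
    fun i j => (continuous_rotProd φ).matrix_elem i j
  have hAc : Continuous A := by
    rw [funext hA]
    fun_prop
  have hCc : Continuous C := by
    rw [funext hC]
    fun_prop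
  refine ⟨φ, fun θ => ⟨congrFun (Continuous.ext_on dense_setOf_cos_half_ne_zero
    (Complex.continuous_re.comp (hent 0 0)) hAc fun θ hθ => ?_) θ,
    congrFun (Continuous.ext_on dense_setOf_cos_half_ne_zero
    (Complex.continuous_im.comp (hent 1 0)) hCc fun θ hθ => ?_) θ⟩⟩
  · simp only [Function.comp_apply, (hφ θ hθ).1, hp θ hθ, ← Complex.ofReal_pow, eval_add,
      eval_mul, eval_C, heval, Complex.re_ofReal_mul]
    simp
  · simp only [Function.comp_apply, (hφ θ hθ).2, hq θ hθ, ← Complex.ofReal_pow, eval_sub,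
      eval_mul, eval_C, heval, Complex.im_ofReal_mul]
    simp

theorem achievable_AC (N : ℕ) (hN : 0 < N) (hNeven : Even N) (A C : ℝ → ℝ) :
    (∃ (φ : Fin N → ℝ) (B D : ℝ → ℝ), ∀ θ : ℝ,
        rotProd φ θ =
          (A θ : ℂ) • (1 : Matrix (Fin 2) (Fin 2) ℂ) +
          (Complex.I * (B θ : ℂ)) • σz +
          (Complex.I * (C θ : ℂ)) • σx +
          (Complex.I * (D θ : ℂ)) • σy) ↔
      ((∀ θ : ℝ, A θ ^ 2 + C θ ^ 2 ≤ 1) ∧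
       (A 0 = 1) ∧
       (∃ a : Fin (N / 2 + 1) → ℝ, ∀ θ : ℝ,
          A θ = ∑ k : Fin (N / 2 + 1), a k * Real.cos ((k : ℕ) * θ)) ∧
       (∃ c : Fin (N / 2) → ℝ, ∀ θ : ℝ,
          C θ = ∑ k : Fin (N / 2), c k * Real.sin (((k : ℕ) + 1) * θ))) := by
  obtain ⟨n, rfl⟩ := hNeven
  rw [show (n + n) / 2 = n by omega]
  constructor
  · rintro ⟨φ, B, D, h⟩
    have hA : ∀ θ, (rotProd φ θ 0 0).re = A θ := fun θ => by simp [h, σx, σy, σz]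
    have hC : ∀ θ, (rotProd φ θ 1 0).im = C θ := fun θ => by simp [h, σx, σy, σz]
    obtain ⟨hP, hQ⟩ := rotProd_mem_span φ
    refine ⟨fun θ => ?_, ?_, ?_, ?_⟩
    · have hdet := det_rotProd φ θ
      obtain ⟨h1, h2⟩ := rotProd_conj φ θ
      rw [Matrix.det_fin_two, h1, h2] at hdet
      have := congrArg Complex.re hdet
      simp only [Complex.sub_re, Complex.mul_re, Complex.neg_re, Complex.neg_im,
        Complex.conj_re, Complex.conj_im, Complex.one_re, hA, hC] at this
      nlinarith [sq_nonneg (rotProd φ θ 0 0).im, sq_nonneg (rotProd φ θ 1 0).re]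
    · have hR : ∀ x, Rot x 0 = 1 := fun x => by
        ext i j
        fin_cases i <;> fin_cases j <;> simp [Rot]
      rw [← hA]
      simp [rotProd, hR]
    · obtain ⟨a, ha⟩ := exists_real_coeff_of_mem_span (span_cosMode_le n hP) 1
      exact ⟨a, fun θ => by rw [← ha, one_mul, hA]⟩
    · obtain ⟨c, hc⟩ := exists_real_coeff_of_mem_span (span_sinMode_le n hQ) (-Complex.I)
      exact ⟨c, fun θ => by rw [← hc, ← hC]; simp⟩
  · rintro ⟨hAC, hA0, ⟨a, ha⟩, ⟨c, hc⟩⟩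
    obtain ⟨φ, hφ⟩ := exists_rotProd_re_im_eq hAC hA0 a ha c hc
    refine ⟨φ, fun θ => (rotProd φ θ 0 0).im, fun θ => -(rotProd φ θ 1 0).re, fun θ => ?_⟩
    rw [← (hφ θ).1, ← (hφ θ).2]
    exact eq_pauli_combination_of_conj (rotProd_conj φ θ).1 (rotProd_conj φ θ).2
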